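/- arXiv:2406.07889 — 4 statements merged into one kernel-verified Lean document; each statement's English description precedes it below -/
import Mathlib

section
/- Let T > 0, L > 0, ε > 0 and x₀ ∈ ℝ. Let θ : [0,T] → ℝ be measurable with |θ(t)| ≤ L for all t ∈ [0,T], let w : [0,T] → ℝ be continuous with w(0) = 0, and let X : [0,T] → ℝ be continuous and satisfy the integral equation X_t = x₀ + ∫₀^t θ(v) X_v dv + ε w(t) for all t ∈ [0,T]. Let x_t = x₀ exp(∫₀^t θ(s) ds). Then for every t ∈ [0,T], |X_t − x_t| ≤ ε e^{L t} · sup_{0 ≤ s ≤ t} |w(s)|. -/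
open MeasureTheory Real

open Set Filter Topology in
/-- Grönwall's inequality in integral form, with constant coefficients. -/
theorem le_mul_exp_of_le_add_mul_integral {f : ℝ → ℝ} {δ K a b : ℝ} (hK : 0 ≤ K)
    (hf : ContinuousOn f (Icc a b))
    (bound : ∀ s ∈ Icc a b, f s ≤ δ + K * ∫ v in a..s, f v) :
    ∀ s ∈ Icc a b, f s ≤ δ * exp (K * (s - a)) := by
  intro s hs
  have hab : a ≤ b := hs.1.trans hs.2
  have hint : IntervalIntegrable f volume a b := hf.intervalIntegrable_of_Icc hab
  set F : ℝ → ℝ := fun s => δ + K * ∫ v in a..s, f v with hF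
  have hF_cont : ContinuousOn F (Icc a b) := by
    have h := intervalIntegral.continuousOn_primitive_interval' hint left_mem_uIcc
    rw [uIcc_of_le hab] at h
    exact continuousOn_const.add (continuousOn_const.mul h)
  have hF_deriv : ∀ y ∈ Ico a b, HasDerivWithinAt F (K * f y) (Ici y) y := by
    intro y hy
    have hmem : Icc a b ∈ 𝓝[>] y :=
      mem_of_superset (Ioc_mem_nhdsGT hy.2) fun z hz => ⟨hy.1.trans hz.1.le, hz.2⟩
    have hy' : y ∈ Icc a b := Ico_subset_Icc_self hy
    have h := intervalIntegral.integral_hasDerivWithinAt_right (s := Ici y) (t := Ioi y)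
      (hint.mono_set (by rw [uIcc_of_le hab, uIcc_of_le hy.1]; exact Icc_subset_Icc_right hy.2.le))
      ⟨Icc a b, hmem, hf.aestronglyMeasurable measurableSet_Icc⟩
      ((hf y hy').mono_of_mem_nhdsWithin hmem)
    exact (h.const_mul K).const_add δ
  have hF_le := le_gronwallBound_of_liminf_deriv_right_le (K := K) (δ := δ) (ε := 0) hF_cont
    (fun y hy r hr => (hF_deriv y hy).liminf_right_slope_le hr) (by simp [hF])
    (fun y hy => by
      simpa using mul_le_mul_of_nonneg_left (bound y (Ico_subset_Icc_self hy)) hK) s hs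
  rw [gronwallBound_ε0] at hF_le
  exact (bound s hs).trans hF_le

open Set NNReal in
/-- Composing an absolutely continuous function with a Lipschitz function on the left gives an
absolutely continuous function. -/
theorem LipschitzOnWith.comp_absolutelyContinuousOnInterval {X Y : Type*} [PseudoMetricSpace X]
    [PseudoMetricSpace Y] {g : X → Y} {f : ℝ → X} {K : ℝ≥0} {S : Set X} {a b : ℝ}
    (hg : LipschitzOnWith K g S) (hf : AbsolutelyContinuousOnInterval f a b)
    (hS : MapsTo f (uIcc a b) S) :
    AbsolutelyContinuousOnInterval (g ∘ f) a b := by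
  rw [absolutelyContinuousOnInterval_iff] at hf ⊢
  intro ε hε
  obtain ⟨δ, hδ, h⟩ := hf (ε / (K + 1)) (by positivity)
  refine ⟨δ, hδ, fun E hE hlen => ?_⟩
  have hsum := h E hE hlen
  calc
    _ ≤ ∑ i ∈ Finset.range E.1, K * dist (f (E.2 i).1) (f (E.2 i).2) := by
      refine Finset.sum_le_sum fun i hi => ?_
      exact hg.dist_le_mul _ (hS (hE.1 i hi).1) _ (hS (hE.1 i hi).2)
    _ = K * ∑ i ∈ Finset.range E.1, dist (f (E.2 i).1) (f (E.2 i).2) := by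
      rw [Finset.mul_sum]
    _ ≤ K * (ε / (K + 1)) := by gcongr
    _ < ε := by
      rw [mul_div_assoc', div_lt_iff₀ (by positivity)]
      nlinarith

open Set in
/-- The exponential of the primitive of an integrable function `θ` solves `y' = θ y` in integral
form. -/
theorem integral_mul_exp_integral {θ : ℝ → ℝ} {a b : ℝ}
    (hθ : IntervalIntegrable θ volume a b) :
    ∫ v in a..b, θ v * exp (∫ s in a..v, θ s) = exp (∫ s in a..b, θ s) - 1 := by
  set A : ℝ → ℝ := fun v => ∫ s in a..v, θ s with hA
  have hA_ac : AbsolutelyContinuousOnInterval A a b :=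
    hθ.absolutelyContinuousOnInterval_intervalIntegral left_mem_uIcc
  obtain ⟨C, hC⟩ := hA_ac.exists_bound
  obtain ⟨K, hK⟩ := (contDiff_exp (n := 1)).contDiffOn.exists_lipschitzOnWith (by decide)
    (convex_Icc (-C) C) isCompact_Icc
  have hexp_ac : AbsolutelyContinuousOnInterval (fun v => exp (A v)) a b :=
    hK.comp_absolutelyContinuousOnInterval hA_ac fun v hv => abs_le.1 (hC v hv)
  have hA_a : exp (A a) = 1 := by simp [hA]
  rw [← hA_a, ← hexp_ac.integral_deriv_eq_sub]
  refine intervalIntegral.integral_congr_ae ?_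
  filter_upwards [hθ.ae_hasDerivAt_integral] with v hv hmem
  rw [(hv (uIoc_subset_uIcc hmem) a left_mem_uIcc).exp.deriv, mul_comm]

/-- Gronwall comparison between the solution `X` of the perturbed linear equation
`dX_t = θ(t) X_t dt + ε dw(t), X_0 = x₀` and the solution
`x_t = x₀ exp(∫₀ᵗ θ(s) ds)` of the unperturbed equation, when `|θ| ≤ L` on `[0, T]`. -/
theorem pathwise_gronwall_comparison
    (T L ε x₀ : ℝ) (hT : 0 < T) (hL : 0 < L) (hε : 0 < ε)
    (θ w X : ℝ → ℝ) (hθ_meas : Measurable θ)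
    (hθ_bdd : ∀ t ∈ Set.Icc (0:ℝ) T, |θ t| ≤ L)
    (hw_cont : ContinuousOn w (Set.Icc 0 T)) (hw0 : w 0 = 0)
    (hX_cont : ContinuousOn X (Set.Icc 0 T))
    (hX_eq : ∀ t ∈ Set.Icc (0:ℝ) T,
      X t = x₀ + (∫ v in (0:ℝ)..t, θ v * X v) + ε * w t)
    (x : ℝ → ℝ)
    (hx : ∀ t, x t = x₀ * Real.exp (∫ s in (0:ℝ)..t, θ s)) :
    ∀ t ∈ Set.Icc (0:ℝ) T,
      |X t - x t| ≤ ε * Real.exp (L * t) * sSup ((fun s => |w s|) '' Set.Icc 0 t) := by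
  intro t ht
  have hsub : Set.Icc 0 t ⊆ Set.Icc 0 T := Set.Icc_subset_Icc_right ht.2
  set M := sSup ((fun s => |w s|) '' Set.Icc 0 t) with hM
  have hw_le : ∀ s ∈ Set.Icc 0 t, |w s| ≤ M := fun s hs =>
    le_csSup (isCompact_Icc.bddAbove_image (hw_cont.mono hsub).abs) (Set.mem_image_of_mem _ hs)
  have hθ_int : ∀ s ∈ Set.Icc 0 T, IntervalIntegrable θ volume 0 s := by
    intro s hs
    rw [intervalIntegrable_iff_integrableOn_Icc_of_le hs.1]
    refine Measure.integrableOn_of_bounded (M := L) (by simp) hθ_meas.aestronglyMeasurable ?_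
    refine (ae_restrict_iff' measurableSet_Icc).2 (ae_of_all _ fun v hv => ?_)
    exact hθ_bdd v ⟨hv.1, hv.2.trans hs.2⟩
  have hx_cont : ContinuousOn x (Set.Icc 0 T) := by
    have h := intervalIntegral.continuousOn_primitive_interval'
      (hθ_int T (Set.right_mem_Icc.2 hT.le)) Set.left_mem_uIcc
    rw [Set.uIcc_of_le hT.le] at h
    exact (continuousOn_const.mul h.rexp).congr fun s _ => hx s
  have hx_eq : ∀ s ∈ Set.Icc 0 T, x s = x₀ + ∫ v in (0:ℝ)..s, θ v * x v := by
    intro s hs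
    simp_rw [hx, mul_left_comm (θ _) x₀]
    rw [intervalIntegral.integral_const_mul, integral_mul_exp_integral (hθ_int s hs)]
    ring
  have hmul_int : ∀ s ∈ Set.Icc 0 T, ∀ Y : ℝ → ℝ, ContinuousOn Y (Set.Icc 0 T) →
      IntervalIntegrable (fun v => θ v * Y v) volume 0 s := by
    intro s hs Y hY
    refine (hθ_int s hs).mul_continuousOn (hY.mono ?_)
    rw [Set.uIcc_of_le hs.1]
    exact Set.Icc_subset_Icc_right hs.2
  have hD_cont : ContinuousOn (fun s => |X s - x s|) (Set.Icc 0 T) := (hX_cont.sub hx_cont).abs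
  have hD_le : ∀ s ∈ Set.Icc 0 t,
      |X s - x s| ≤ ε * M + L * ∫ v in (0:ℝ)..s, |X v - x v| := by
    intro s hs
    have hs' := hsub hs
    have hD_eq : X s - x s = ε * w s + ∫ v in (0:ℝ)..s, θ v * (X v - x v) := by
      simp_rw [mul_sub]
      rw [intervalIntegral.integral_sub (hmul_int s hs' X hX_cont) (hmul_int s hs' x hx_cont),
        hX_eq s hs', hx_eq s hs']
      ring
    have hint_le : |∫ v in (0:ℝ)..s, θ v * (X v - x v)| ≤ L * ∫ v in (0:ℝ)..s, |X v - x v| := by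
      rw [← intervalIntegral.integral_const_mul]
      rw [← norm_eq_abs]
      refine intervalIntegral.norm_integral_le_of_norm_le hs.1 (ae_of_all _ fun v hv => ?_) ?_
      · rw [norm_mul]
        exact mul_le_mul_of_nonneg_right (hθ_bdd v ⟨hv.1.le, hv.2.trans hs'.2⟩) (norm_nonneg _)
      · exact ((hD_cont.mono (Set.Icc_subset_Icc_right hs'.2)).intervalIntegrable_of_Icc
          hs.1).const_mul L
    rw [hD_eq]
    refine (abs_add_le _ _).trans (add_le_add ?_ hint_le)
    rw [abs_mul, abs_of_pos hε]
    exact mul_le_mul_of_nonneg_left (hw_le s hs) hε.le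
  have h := le_mul_exp_of_le_add_mul_integral hL.le (hD_cont.mono hsub) hD_le t
    (Set.right_mem_Icc.2 ht.1)
  rw [sub_zero] at h
  linarith
end

section
/- Let k ≥ 1 be an integer, A < 0 < B, and let G : ℝ → ℝ be a bounded measurable function vanishing outside [A,B] with ∫_A^B G(u) du = 1 and ∫_A^B u^j G(u) du = 0 for j = 1, …, k. Let M > 0 and let J : ℝ → ℝ be k-times differentiable with |J^{(k)}(x) − J^{(k)}(y)| ≤ M |x − y| for all x, y ∈ ℝ. Then for every t ∈ ℝ and φ > 0, |∫_A^B G(u) (J(t + φ u) − J(t)) du| ≤ (M / k!) φ^{k+1} ∫_A^B |u|^{k+1} |G(u)| du. -/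
open MeasureTheory Real

/-- If the `k`-th derivative of `f` is `M`-Lipschitz, the error of the Taylor polynomial of degree
`k` is at most `M / k! * |x - t| ^ (k + 1)`. -/
theorem abs_sub_taylor_le_of_lipschitz_iteratedDeriv {f : ℝ → ℝ} {k : ℕ} {M : ℝ} (hk : 1 ≤ k)
    (hf : ContDiff ℝ k f)
    (hlip : ∀ x y : ℝ, |iteratedDeriv k f x - iteratedDeriv k f y| ≤ M * |x - y|) (t x : ℝ) :
    |f x - ∑ j ∈ Finset.range (k + 1), iteratedDeriv j f t / j.factorial * (x - t) ^ j|
      ≤ M / k.factorial * |x - t| ^ (k + 1) := by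
  rcases eq_or_ne t x with rfl | hx
  · simp [Finset.sum_range_succ']
  have hM : 0 ≤ M := by
    have h := (abs_nonneg _).trans (hlip 1 0)
    simpa using h
  obtain ⟨n, rfl⟩ := Nat.exists_eq_add_of_le' hk
  obtain ⟨ξ, hξ, h⟩ := taylor_mean_remainder_lagrange_iteratedDeriv (n := n) hx
    (hf.contDiffOn.of_le (by norm_cast))
  have hpoly : taylorWithinEval f n (Set.uIcc t x) t x
      = ∑ j ∈ Finset.range (n + 1), iteratedDeriv j f t / j.factorial * (x - t) ^ j := by
    rw [taylor_within_apply]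
    refine Finset.sum_congr rfl fun j hj => ?_
    have hjn : j ≤ n + 1 := (Finset.mem_range.1 hj).le
    rw [iteratedDerivWithin_eq_iteratedDeriv (uniqueDiffOn_uIcc hx)
      (hf.contDiffAt.of_le (by exact_mod_cast hjn)) Set.left_mem_uIcc, smul_eq_mul]
    ring
  rw [hpoly] at h
  have hrem : f x - ∑ j ∈ Finset.range (n + 1 + 1),
        iteratedDeriv j f t / j.factorial * (x - t) ^ j
      = (iteratedDeriv (n + 1) f ξ - iteratedDeriv (n + 1) f t) * (x - t) ^ (n + 1)
        / (n + 1).factorial := by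
    rw [Finset.sum_range_succ, ← sub_sub, h]
    ring
  have hdist : |ξ - t| ≤ |x - t| := Set.abs_sub_left_of_mem_uIcc (Set.uIoo_subset_uIcc_self hξ)
  rw [hrem, abs_div, abs_mul, abs_pow, Nat.abs_cast]
  calc |iteratedDeriv (n + 1) f ξ - iteratedDeriv (n + 1) f t| * |x - t| ^ (n + 1)
        / (n + 1).factorial
      ≤ M * |x - t| * |x - t| ^ (n + 1) / (n + 1).factorial := by
        gcongr
        exact (hlip ξ t).trans (by gcongr)
    _ = M / (n + 1).factorial * |x - t| ^ (n + 1 + 1) := by ring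

/-- Taylor-expansion kernel bias bound: if the kernel `G` has vanishing moments of
orders `1,…,k` and `J` is `k`-times differentiable with `M`-Lipschitz `k`-th derivative,
then `|∫_A^B G(u)(J(t+φu) - J(t)) du| ≤ (M/k!) φ^{k+1} ∫_A^B |u|^{k+1}|G(u)| du`. -/
theorem kernel_bias_bound_vanishing_moments
    (k : ℕ) (hk : 1 ≤ k) (A B M : ℝ) (hA : A < 0) (hB : 0 < B) (hM : 0 < M)
    (G : ℝ → ℝ) (hG_meas : Measurable G) (hG_bdd : ∃ C, ∀ u, |G u| ≤ C)
    (hG_supp : ∀ u ∉ Set.Icc A B, G u = 0)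
    (hG_int : ∫ u in A..B, G u = 1)
    (hG_mom : ∀ j, 1 ≤ j → j ≤ k → ∫ u in A..B, u^j * G u = 0)
    (J : ℝ → ℝ) (hJ_diff : ∀ n < k, Differentiable ℝ (iteratedDeriv n J))
    (hJ_lip : ∀ x y : ℝ, |iteratedDeriv k J x - iteratedDeriv k J y| ≤ M * |x - y|) :
    ∀ (t φ : ℝ), 0 < φ →
      |∫ u in A..B, G u * (J (t + φ * u) - J t)|
        ≤ (M / (Nat.factorial k)) * φ^(k+1) * ∫ u in A..B, |u|^(k+1) * |G u| := by
  intro t φ hφ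
  have hAB : A ≤ B := (hA.trans hB).le
  have hJ : ContDiff ℝ k J := by
    refine contDiff_nat_iff_iteratedDeriv.2 ⟨fun m hm => ?_, hJ_diff⟩
    rcases hm.lt_or_eq with hm | rfl
    · exact (hJ_diff m hm).continuous
    · exact (LipschitzWith.of_dist_le_mul (K := ⟨M, hM.le⟩) hJ_lip).continuous
  have hG : IntervalIntegrable G volume A B := by
    obtain ⟨C, hC⟩ := hG_bdd
    exact (intervalIntegrable_const (c := C)).mono_fun' hG_meas.aestronglyMeasurable
      (Filter.Eventually.of_forall hC)
  set c : ℕ → ℝ := fun j => iteratedDeriv j J t / j.factorial * φ ^ j with hc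
  have hterm : ∀ j, IntervalIntegrable (fun u => c j * (u ^ j * G u)) volume A B := fun j =>
    (hG.continuousOn_mul (continuous_pow j).continuousOn).const_mul (c j)
  have hpoly_int : IntervalIntegrable
      (fun u => ∑ j ∈ Finset.range k, c (j + 1) * (u ^ (j + 1) * G u)) volume A B := by
    simpa only [Finset.sum_fn] using IntervalIntegrable.sum (Finset.range k)
      (f := fun j u => c (j + 1) * (u ^ (j + 1) * G u)) fun j _ => hterm (j + 1)
  have hpoly : ∫ u in A..B, ∑ j ∈ Finset.range k, c (j + 1) * (u ^ (j + 1) * G u) = 0 := by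
    rw [intervalIntegral.integral_finsetSum fun j _ => hterm (j + 1)]
    refine Finset.sum_eq_zero fun j hj => ?_
    rw [intervalIntegral.integral_const_mul,
      hG_mom (j + 1) (Nat.le_add_left 1 j) (Finset.mem_range.1 hj), mul_zero]
  have hinc : IntervalIntegrable (fun u => G u * (J (t + φ * u) - J t)) volume A B := by
    have hJc := hJ.continuous
    exact hG.mul_continuousOn (by fun_prop)
  rw [← sub_zero (∫ u in A..B, G u * (J (t + φ * u) - J t)), ← hpoly,
    ← intervalIntegral.integral_sub hinc hpoly_int, ← intervalIntegral.integral_const_mul,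
    ← Real.norm_eq_abs]
  refine intervalIntegral.norm_integral_le_of_norm_le hAB
    (Filter.Eventually.of_forall fun u _ => ?_)
    ((hG.abs.continuousOn_mul (by fun_prop)).const_mul _)
  have htaylor := abs_sub_taylor_le_of_lipschitz_iteratedDeriv hk hJ hJ_lip t (t + φ * u)
  have hfactor : G u * (J (t + φ * u) - J t)
        - ∑ j ∈ Finset.range k, c (j + 1) * (u ^ (j + 1) * G u)
      = G u * (J (t + φ * u) - ∑ j ∈ Finset.range (k + 1),
          iteratedDeriv j J t / j.factorial * (t + φ * u - t) ^ j) := by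
    have hsum : ∑ j ∈ Finset.range k, c (j + 1) * (u ^ (j + 1) * G u)
        = G u * ∑ j ∈ Finset.range k,
          iteratedDeriv (j + 1) J t / (j + 1).factorial * (φ * u) ^ (j + 1) := by
      rw [Finset.mul_sum]
      refine Finset.sum_congr rfl fun j _ => ?_
      simp only [hc]
      ring
    rw [hsum, Finset.sum_range_succ', add_sub_cancel_left]
    simp only [iteratedDeriv_zero, Nat.factorial_zero, Nat.cast_one, div_one, pow_zero, mul_one]
    ring
  rw [hfactor, Real.norm_eq_abs, abs_mul]
  rw [add_sub_cancel_left, abs_mul, abs_of_pos hφ] at htaylor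
  rw [add_sub_cancel_left]
  calc _ ≤ |G u| * (M / k.factorial * (φ * |u|) ^ (k + 1)) := by gcongr
    _ = _ := by ring
end

section
/- Let H ∈ (0,1), K ∈ (0,1] with HK ∈ (1/2, 1), and set Q_{H,K}(s,t) = 2^{2−K} H² K (K−1) (t^{2H} + s^{2H})^{K−2} (s t)^{2H−1} + 2^{1−K} H K (2HK−1) |t − s|^{2HK−2} for s, t > 0 with s ≠ t. Let A < 0 < B, let G : ℝ → ℝ be a bounded measurable function vanishing outside [A,B], and let 0 < a ≤ b. Then there exist constants C > 0 and φ₀ > 0 with a + φ₀ A > 0 such that for all t ∈ [a,b] and all φ ∈ (0, φ₀], |∫_A^B ∫_A^B G(u) G(v) Q_{H,K}(t + φ u, t + φ v) du dv| ≤ C (1 + φ^{2HK−2}). -/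
open MeasureTheory Real

/-- A real power of `|x|` with exponent above `-1` is integrable on every interval. -/
lemma intervalIntegrable_abs_rpow {p : ℝ} (hp : -1 < p) (a b : ℝ) :
    IntervalIntegrable (fun x : ℝ => |x| ^ p) volume a b := by
  refine intervalIntegrable_of_even (fun x => by simp) fun x hx => ?_
  refine (intervalIntegral.intervalIntegrable_rpow' (a := 0) (b := x) hp).congr ?_
  intro y hy
  rw [Set.uIoc_of_le hx.le] at hy
  simp only [abs_of_pos hy.1]

/-- The integral of a translate of `|x| ^ p` is bounded uniformly in the centre of translation. -/
lemma integral_abs_sub_rpow_le {p A B u : ℝ} (hp : -1 < p) (hu : u ∈ Set.Icc A B) :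
    ∫ v in A..B, |v - u| ^ p ≤ ∫ w in (-(B - A))..(B - A), |w| ^ p := by
  rw [intervalIntegral.integral_comp_sub_right (fun w : ℝ => |w| ^ p)]
  refine intervalIntegral.integral_mono_interval (by linarith [hu.1, hu.2])
    (by linarith [hu.1, hu.2]) (by linarith [hu.1, hu.2]) ?_ (intervalIntegrable_abs_rpow hp _ _)
  exact Filter.Eventually.of_forall fun w => by positivity

/-- The smooth part of the mixed derivative of the bifractional covariance is bounded on compact
squares away from the origin. -/
lemma exists_bound_smooth_part (c p q r : ℝ) {m N : ℝ} (hm : 0 < m) :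
    ∃ D, 0 ≤ D ∧ ∀ x ∈ Set.Icc m N, ∀ y ∈ Set.Icc m N,
      |c * (y ^ p + x ^ p) ^ q * (x * y) ^ r| ≤ D := by
  have hpos : ∀ z ∈ Set.Icc m N ×ˢ Set.Icc m N, 0 < z.1 ∧ 0 < z.2 := fun z hz =>
    ⟨hm.trans_le hz.1.1, hm.trans_le hz.2.1⟩
  have hcont : ContinuousOn (fun z : ℝ × ℝ => c * (z.2 ^ p + z.1 ^ p) ^ q * (z.1 * z.2) ^ r)
      (Set.Icc m N ×ˢ Set.Icc m N) := by
    refine (continuousOn_const.mul (ContinuousOn.rpow_const (ContinuousOn.add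
      (continuousOn_snd.rpow_const fun z hz => Or.inl (hpos z hz).2.ne')
      (continuousOn_fst.rpow_const fun z hz => Or.inl (hpos z hz).1.ne')) fun z hz => Or.inl ?_)).mul
      (ContinuousOn.rpow_const (continuousOn_fst.mul continuousOn_snd) fun z hz => Or.inl ?_)
    · have h := hpos z hz
      exact (add_pos (rpow_pos_of_pos h.2 p) (rpow_pos_of_pos h.1 p)).ne'
    · exact (mul_pos (hpos z hz).1 (hpos z hz).2).ne'
  obtain ⟨D, hD⟩ := (isCompact_Icc.prod isCompact_Icc).exists_bound_of_continuousOn hcont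
  exact ⟨max D 0, le_max_right _ _, fun x hx y hy => (hD (x, y) ⟨hx, hy⟩).trans (le_max_left _ _)⟩

/-- Variance-term bound for the kernel estimator: with `Q_{H,K}` the mixed second
partial derivative of the bifractional Brownian covariance (`HK ∈ (1/2,1)`), for `t`
ranging in a compact `[a,b] ⊂ (0,∞)` and small bandwidths `φ`,
`|∫_A^B ∫_A^B G(u)G(v) Q_{H,K}(t+φu, t+φv) du dv| ≤ C (1 + φ^{2HK-2})`. -/
theorem bifBm_kernel_variance_bound
    (H K : ℝ) (hH : H ∈ Set.Ioo (0:ℝ) 1) (hK : K ∈ Set.Ioc (0:ℝ) 1)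
    (hHK : H * K ∈ Set.Ioo (1/2 : ℝ) 1)
    (Q : ℝ → ℝ → ℝ)
    (hQ : ∀ s t : ℝ, 0 < s → 0 < t → s ≠ t →
      Q s t = 2 ^ (2-K) * H^2 * K * (K-1) * (t ^ (2*H) + s ^ (2*H)) ^ (K-2)
            * (s*t) ^ (2*H-1)
          + 2 ^ (1-K) * H * K * (2*H*K - 1) * |t - s| ^ (2*H*K - 2))
    (A B a b : ℝ) (hA : A < 0) (hB : 0 < B) (ha : 0 < a) (hab : a ≤ b)
    (G : ℝ → ℝ) (hG_meas : Measurable G) (hG_bdd : ∃ C, ∀ u, |G u| ≤ C)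
    (hG_supp : ∀ u ∉ Set.Icc A B, G u = 0) :
    ∃ C > 0, ∃ φ₀ > 0, 0 < a + φ₀ * A ∧
      ∀ t ∈ Set.Icc a b, ∀ φ ∈ Set.Ioc (0:ℝ) φ₀,
        |∫ u in A..B, ∫ v in A..B, G u * G v * Q (t + φ * u) (t + φ * v)|
          ≤ C * (1 + φ ^ (2*H*K - 2)) := by
  obtain ⟨M₀, hM₀⟩ := hG_bdd
  obtain ⟨M, hM0, hM⟩ : ∃ M, 0 ≤ M ∧ ∀ u, |G u| ≤ M :=
    ⟨M₀, (abs_nonneg _).trans (hM₀ 0), hM₀⟩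
  set p : ℝ := 2 * H * K - 2 with hp_def
  have hp : -1 < p := by linarith [hHK.1]
  have hAB : A ≤ B := (hA.trans hB).le
  set φ₀ : ℝ := a / (2 * -A)
  have hφ₀ : 0 < φ₀ := div_pos ha (by linarith)
  have hφA : φ₀ * A = -(a / 2) := by
    have := hA.ne
    simp only [φ₀]
    field_simp
  obtain ⟨D, hD0, hD⟩ := exists_bound_smooth_part (2 ^ (2-K) * H^2 * K * (K-1)) (2*H) (K-2) (2*H-1)
    (N := b + φ₀ * B) (half_pos ha)
  set c : ℝ := 2 ^ (1-K) * H * K * (2*H*K - 1)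
  set E : ℝ := ∫ w in (-(B - A))..(B - A), |w| ^ p
  have hE : 0 ≤ E :=
    intervalIntegral.integral_nonneg (by linarith) fun w _ => by positivity
  have hL : 0 ≤ M ^ 2 * (D * (B - A) + |c| * E) := by
    have : 0 ≤ B - A := by linarith
    positivity
  refine ⟨M ^ 2 * (D * (B - A) + |c| * E) * (B - A) + 1, ?_, φ₀, hφ₀, by linarith, ?_⟩
  · have := mul_nonneg hL (sub_nonneg.2 hAB)
    linarith
  intro t ht φ hφ
  have hmem : ∀ u ∈ Set.Icc A B, t + φ * u ∈ Set.Icc (a / 2) (b + φ₀ * B) := by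
    intro u hu
    have h1 : φ₀ * A ≤ φ * A := mul_le_mul_of_nonpos_right hφ.2 hA.le
    have h2 : φ * A ≤ φ * u := mul_le_mul_of_nonneg_left hu.1 hφ.1.le
    have h3 : φ * u ≤ φ * B := mul_le_mul_of_nonneg_left hu.2 hφ.1.le
    have h4 : φ * B ≤ φ₀ * B := mul_le_mul_of_nonneg_right hφ.2 hB.le
    constructor <;> linarith [ht.1, ht.2]
  have hφp : 0 ≤ φ ^ p := rpow_nonneg hφ.1.le p
  have hpt : ∀ u ∈ Set.Icc A B, ∀ v ∈ Set.Icc A B, v ≠ u →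
      ‖G u * G v * Q (t + φ * u) (t + φ * v)‖ ≤ M ^ 2 * (D + |c| * φ ^ p * |v - u| ^ p) := by
    intro u hu v hv hvu
    have hx := hmem u hu
    have hy := hmem v hv
    have hne : t + φ * u ≠ t + φ * v := fun h =>
      hvu (mul_left_cancel₀ hφ.1.ne' (add_left_cancel h)).symm
    have habs : |t + φ * v - (t + φ * u)| ^ p = φ ^ p * |v - u| ^ p := by
      rw [show t + φ * v - (t + φ * u) = φ * (v - u) by ring, abs_mul, abs_of_pos hφ.1,
        mul_rpow hφ.1.le (abs_nonneg _)]
    rw [hQ _ _ ((half_pos ha).trans_le hx.1) ((half_pos ha).trans_le hy.1) hne, habs, norm_mul,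
      norm_mul, sq M]
    simp only [Real.norm_eq_abs]
    gcongr
    · exact hM u
    · exact hM v
    refine (abs_add_le _ _).trans (add_le_add (hD _ hx _ hy) ?_)
    rw [abs_mul, abs_of_nonneg (mul_nonneg hφp (rpow_nonneg (abs_nonneg _) p)), mul_assoc]
  have hinner : ∀ u ∈ Set.uIoc A B,
      ‖∫ v in A..B, G u * G v * Q (t + φ * u) (t + φ * v)‖
        ≤ M ^ 2 * (D * (B - A) + |c| * E) * (1 + φ ^ p) := by
    intro u hu
    rw [Set.uIoc_of_le hAB] at hu
    replace hu := Set.Ioc_subset_Icc_self hu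
    have hint : IntervalIntegrable (fun v : ℝ => |v - u| ^ p) volume A B := by
      simpa using (intervalIntegrable_abs_rpow hp (A - u) (B - u)).comp_sub_right u
    have hbound : ∀ᵐ v : ℝ, v ∈ Set.Ioc A B → ‖G u * G v * Q (t + φ * u) (t + φ * v)‖
        ≤ M ^ 2 * (D + |c| * φ ^ p * |v - u| ^ p) := by
      filter_upwards [Measure.ae_ne volume u] with v hv hvm
      exact hpt u hu v (Set.Ioc_subset_Icc_self hvm) hv
    calc _ ≤ ∫ v in A..B, M ^ 2 * (D + |c| * φ ^ p * |v - u| ^ p) :=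
          intervalIntegral.norm_integral_le_of_norm_le hAB hbound
            ((intervalIntegrable_const.add (hint.const_mul _)).const_mul _)
      _ = M ^ 2 * (D * (B - A) + |c| * φ ^ p * ∫ v in A..B, |v - u| ^ p) := by
          rw [intervalIntegral.integral_const_mul, intervalIntegral.integral_add
            intervalIntegrable_const (hint.const_mul _), intervalIntegral.integral_const_mul,
            intervalIntegral.integral_const, smul_eq_mul, mul_comm D]
      _ ≤ M ^ 2 * (D * (B - A) + |c| * φ ^ p * E) := by
          gcongr
          exact integral_abs_sub_rpow_le hp hu
      _ ≤ M ^ 2 * (D * (B - A) + |c| * E) * (1 + φ ^ p) := by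
          have h1 : 0 ≤ M ^ 2 * (D * (B - A)) * φ ^ p := by
            have : 0 ≤ B - A := by linarith
            positivity
          have h2 : 0 ≤ M ^ 2 * (|c| * E) := by positivity
          linarith
  have houter := intervalIntegral.norm_integral_le_of_norm_le_const hinner
  rw [abs_of_nonneg (sub_nonneg.2 hAB), Real.norm_eq_abs] at houter
  linarith
end

section
/- Let H ∈ (0,1) and K ∈ (0,1], and define R_{H,K}(s,t) = 2^{−K} ((t^{2H} + s^{2H})^K − |s − t|^{2HK}) for s, t ≥ 0. Then for all s, t ≥ 0, 2^{−K} |t − s|^{2HK} ≤ t^{2HK} + s^{2HK} − 2 R_{H,K}(s,t) ≤ 2^{1−K} |t − s|^{2HK}. -/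
open MeasureTheory Real

/-- A Clarkson-type lower bound for `(1 + w) ^ K + (1 - w) ^ K`. -/
lemma two_le_rpow_one_add_add_rpow_one_sub {K w : ℝ} (hK0 : 0 < K) (hK1 : K ≤ 1)
    (hw0 : 0 ≤ w) (hw1 : w ≤ 1) :
    2 ≤ (1 + w) ^ K + (1 - w) ^ K + (w ^ 2 / 2) ^ K := by
  have hX1 : (1:ℝ) ≤ 2 ^ K := Real.one_le_rpow (by norm_num) hK0.le
  have hX2 : (2:ℝ) ^ K ≤ 2 := by
    simpa using Real.rpow_le_rpow_of_exponent_le (x := 2) (by norm_num) hK1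
  have hq : 0 ≤ 1 - w := by linarith
  have hr : (w ^ 2 / 2) ^ K = (w ^ 2) ^ K / 2 ^ K := Real.div_rpow (by positivity) (by norm_num) K
  have hw2 : w ^ 2 ≤ 1 := by nlinarith
  have hwK : w ^ 2 ≤ (w ^ 2) ^ K := Real.self_le_rpow_of_le_one (by positivity) hw2 hK1
  rw [hr]
  generalize hX : (2:ℝ) ^ K = X at *
  have hX0 : 0 < X := by linarith
  rcases le_total K (1 / 2) with h | h
  · have hc : 1 + (X - 1) * w ≤ (1 + w) ^ K := by
      have := (Real.concaveOn_rpow hK0.le hK1).2 (x := 1) (y := 2) (by simp) (by simp) hq hw0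
        (by ring)
      simp only [smul_eq_mul, Real.one_rpow, hX] at this
      rw [show (1 - w) * 1 + w * 2 = 1 + w by ring] at this
      linarith
    have hd : 1 - w ≤ (1 - w) ^ K := Real.self_le_rpow_of_le_one hq (by linarith) hK1
    have he : w ≤ (w ^ 2) ^ K := by
      rw [← Real.rpow_natCast_mul hw0]
      exact Real.self_le_rpow_of_le_one hw0 hw1 (by push_cast; linarith)
    have hf : (2 - X) * w ≤ (w ^ 2) ^ K / X := by
      rw [le_div_iff₀ hX0]
      nlinarith [mul_nonneg hw0 (sq_nonneg (X - 1))]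
    linarith
  rcases le_total K (3 / 4) with h' | h'
  · have hX3 : X ≤ 1.7 := by
      have h4 : X ^ 4 ≤ 8 := by
        rw [← hX, ← Real.rpow_mul_natCast (by norm_num)]
        calc (2:ℝ) ^ (K * (4:ℕ)) ≤ 2 ^ (3:ℝ) :=
              Real.rpow_le_rpow_of_exponent_le (by norm_num) (by push_cast; linarith)
          _ = 8 := by norm_num
      by_contra! hlt
      have := pow_lt_pow_left₀ hlt (by norm_num) (n := 4) (by norm_num)
      norm_num at this
      linarith
    have h1 : 1 + (2 * K) * w ≤ ((1 + w) ^ K) ^ 2 := by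
      rw [← Real.rpow_mul_natCast (by linarith), mul_comm K]
      exact one_add_mul_self_le_rpow_one_add (by linarith) (by linarith)
    have h2 : 1 + (2 * K) * (-w) ≤ ((1 - w) ^ K) ^ 2 := by
      rw [← Real.rpow_mul_natCast hq, mul_comm K, sub_eq_add_neg]
      exact one_add_mul_self_le_rpow_one_add (by linarith) (by linarith)
    have h3 : 1 - w ^ 2 ≤ (1 + w) ^ K * (1 - w) ^ K := by
      rw [← Real.mul_rpow (by linarith) hq, show (1 + w) * (1 - w) = 1 - w ^ 2 by ring]
      exact Real.self_le_rpow_of_le_one (by linarith) (by nlinarith) hK1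
    have h4 : w ^ 2 / X ≤ (w ^ 2) ^ K / X := by gcongr
    have h5 : w ^ 2 / X ≤ 4 - 2 * X := by
      rw [div_le_iff₀ hX0]
      nlinarith
    have h6 : w ^ 2 / X * X = w ^ 2 := by field_simp
    have h7 : 0 ≤ w ^ 2 / X := by positivity
    have h8 : 0 ≤ (1 + w) ^ K + (1 - w) ^ K := by positivity
    generalize w ^ 2 / X = y at *
    have h9 : 2 - y ≤ (1 + w) ^ K + (1 - w) ^ K := by
      refine le_of_sq_le_sq ?_ h8
      nlinarith [mul_nonneg h7 (sub_nonneg.2 h5)]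
    linarith
  · have hp : (1 + w) * (1 - (1 - K) * w) ≤ (1 + w) ^ K := by
      have h1 : (1 + w) ^ (1 - K) ≤ 1 + (1 - K) * w :=
        rpow_one_add_le_one_add_mul_self (by linarith) (by linarith) (by linarith)
      have h2 : (1 + w) ^ K * (1 + w) ^ (1 - K) = 1 + w := by
        rw [← Real.rpow_add (by linarith)]; simp
      have h3 : 0 ≤ (1 + w) ^ K := by positivity
      have h4 : 0 ≤ 1 - (1 - K) * w := by nlinarith
      nlinarith [mul_le_mul_of_nonneg_left h1 (mul_nonneg h3 h4),
        mul_nonneg h3 (sq_nonneg ((1 - K) * w))]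
    have hq' : (1 - w) * (1 + (1 - K) * w) ≤ (1 - w) ^ K := by
      have h1 : (1 - w) ^ (1 - K) ≤ 1 + (1 - K) * (-w) :=
        rpow_one_add_le_one_add_mul_self (by linarith) (by linarith) (by linarith)
      have h2 : (1 - w) ^ K * (1 - w) ^ (1 - K) = 1 - w := by
        rw [← Real.rpow_add_of_nonneg hq hK0.le (by linarith)]; simp
      have h3 : 0 ≤ (1 - w) ^ K := by positivity
      have h4 : 0 ≤ 1 + (1 - K) * w := by nlinarith
      nlinarith [mul_le_mul_of_nonneg_left h1 (mul_nonneg h3 h4),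
        mul_nonneg h3 (sq_nonneg ((1 - K) * w))]
    have hf : 2 * (1 - K) * w ^ 2 ≤ (w ^ 2) ^ K / X := by
      rw [le_div_iff₀ hX0]
      have : 2 * (1 - K) * X ≤ 1 := by nlinarith
      nlinarith [mul_le_mul_of_nonneg_left this (sq_nonneg w)]
    linarith

/-- The lower quasi-helix bound in the extremal case `H = 1`. -/
lemma two_mul_rpow_sq_add_sq_le {K u v : ℝ} (hK0 : 0 < K) (hK1 : K ≤ 1)
    (hv : 0 ≤ v) (huv : v ≤ u) :
    2 * (u ^ 2 + v ^ 2) ^ K ≤ 2 ^ K * ((u ^ 2) ^ K + (v ^ 2) ^ K) + ((u - v) ^ 2) ^ K := by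
  rcases (add_nonneg (sq_nonneg u) (sq_nonneg v)).eq_or_lt with hA | hA
  · rw [← hA, Real.zero_rpow hK0.ne', mul_zero]
    positivity
  have hsq : v ^ 2 ≤ u ^ 2 := by gcongr
  generalize hAdef : u ^ 2 + v ^ 2 = A at *
  set w := (u ^ 2 - v ^ 2) / A with hw
  have hw0 : 0 ≤ w := div_nonneg (by linarith) hA.le
  have hw1 : w ≤ 1 := by rw [hw, div_le_one hA]; nlinarith
  have hAw : A * w = u ^ 2 - v ^ 2 := by rw [hw]; field_simp
  have key := mul_le_mul_of_nonneg_left (two_le_rpow_one_add_add_rpow_one_sub hK0 hK1 hw0 hw1)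
    (Real.rpow_nonneg hA.le K)
  rw [mul_add, mul_add, ← Real.mul_rpow hA.le (by linarith), ← Real.mul_rpow hA.le (by linarith),
    ← Real.mul_rpow hA.le (by positivity),
    show A * (1 + w) = 2 * u ^ 2 by linarith, show A * (1 - w) = 2 * v ^ 2 by linarith,
    Real.mul_rpow (by norm_num) (by positivity), Real.mul_rpow (by norm_num) (by positivity)] at key
  have hlast : (A * (w ^ 2 / 2)) ^ K ≤ ((u - v) ^ 2) ^ K := by
    refine Real.rpow_le_rpow (by positivity) ?_ hK0.le
    refine le_of_mul_le_mul_left ?_ hA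
    have h1 : A * (A * (w ^ 2 / 2)) = (u - v) ^ 2 * ((u + v) ^ 2 / 2) := by
      linear_combination (A * w + (u ^ 2 - v ^ 2)) / 2 * hAw
    rw [h1, mul_comm A]
    gcongr
    nlinarith [sq_nonneg (u - v)]
  linarith

/-- Two-point power mean inequality for exponents in `(0, 1]`. -/
lemma rpow_add_rpow_le_two_rpow_mul {K a b : ℝ} (hK0 : 0 < K) (hK1 : K ≤ 1)
    (ha : 0 ≤ a) (hb : 0 ≤ b) :
    a ^ K + b ^ K ≤ 2 ^ (1 - K) * (a + b) ^ K := by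
  have h := (Real.concaveOn_rpow hK0.le hK1).2 (Set.mem_Ici.2 ha) (Set.mem_Ici.2 hb)
    (show (0:ℝ) ≤ 1 / 2 by norm_num) (show (0:ℝ) ≤ 1 / 2 by norm_num) (by norm_num)
  simp only [smul_eq_mul] at h
  rw [show 1 / 2 * a + 1 / 2 * b = (a + b) / 2 by ring,
    Real.div_rpow (by positivity) (by norm_num)] at h
  rw [Real.rpow_sub (by norm_num), Real.rpow_one]
  have : 2 / 2 ^ K * (a + b) ^ K = 2 * ((a + b) ^ K / 2 ^ K) := by ring
  linarith

/-- The lower quasi-helix bound, for ordered arguments. -/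
lemma two_mul_rpow_add_rpow_le {H K s t : ℝ} (hH0 : 0 < H) (hH1 : H ≤ 1)
    (hK0 : 0 < K) (hK1 : K ≤ 1) (hs : 0 ≤ s) (hst : s ≤ t) :
    2 * (t ^ (2 * H) + s ^ (2 * H)) ^ K
      ≤ 2 ^ K * (t ^ (2 * H * K) + s ^ (2 * H * K)) + |t - s| ^ (2 * H * K) := by
  have ht : 0 ≤ t := hs.trans hst
  have hd : 0 ≤ t - s := sub_nonneg.2 hst
  have hpow : ∀ x : ℝ, 0 ≤ x → x ^ (2 * H) = (x ^ H) ^ 2 := fun x hx => by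
    rw [← Real.rpow_mul_natCast hx, mul_comm]; norm_num
  have hmono : s ^ H ≤ t ^ H := Real.rpow_le_rpow hs hst hH0.le
  have hsub : t ^ H - s ^ H ≤ (t - s) ^ H := by
    have := Real.rpow_add_le_add_rpow hd hs hH0.le hH1
    rw [sub_add_cancel] at this
    linarith
  have key := two_mul_rpow_sq_add_sq_le hK0 hK1 (Real.rpow_nonneg hs H) hmono
  rw [abs_of_nonneg hd, Real.rpow_mul ht (2 * H), Real.rpow_mul hs (2 * H),
    Real.rpow_mul hd (2 * H), hpow t ht, hpow s hs, hpow _ hd]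
  have : ((t ^ H - s ^ H) ^ 2) ^ K ≤ (((t - s) ^ H) ^ 2) ^ K := by
    refine Real.rpow_le_rpow (by positivity) ?_ hK0.le
    exact pow_le_pow_left₀ (sub_nonneg.2 hmono) hsub 2
  linarith

/-- Quasi-helix property of the bifractional Brownian motion: with
`R_{H,K}(s,t) = 2^{-K}((t^{2H}+s^{2H})^K - |s-t|^{2HK})` its covariance function,
the squared increment `E[(W_t^{H,K} - W_s^{H,K})²] = t^{2HK} + s^{2HK} - 2R_{H,K}(s,t)`
satisfies `2^{-K}|t-s|^{2HK} ≤ · ≤ 2^{1-K}|t-s|^{2HK}`. -/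
theorem bifBm_quasi_helix
    (H K : ℝ) (hH : H ∈ Set.Ioo (0:ℝ) 1) (hK : K ∈ Set.Ioc (0:ℝ) 1)
    (R : ℝ → ℝ → ℝ)
    (hR : ∀ s t : ℝ, 0 ≤ s → 0 ≤ t →
      R s t = 2 ^ (-K) * ((t ^ (2*H) + s ^ (2*H)) ^ K - |s - t| ^ (2*H*K))) :
    ∀ s t : ℝ, 0 ≤ s → 0 ≤ t →
      2 ^ (-K) * |t - s| ^ (2*H*K)
          ≤ t ^ (2*H*K) + s ^ (2*H*K) - 2 * R s t ∧
      t ^ (2*H*K) + s ^ (2*H*K) - 2 * R s t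
          ≤ 2 ^ (1-K) * |t - s| ^ (2*H*K) := by
  intro s t hs ht
  obtain ⟨hH0, hH1⟩ := hH
  obtain ⟨hK0, hK1⟩ := hK
  have hlow : 2 * (t ^ (2 * H) + s ^ (2 * H)) ^ K
      ≤ 2 ^ K * (t ^ (2 * H * K) + s ^ (2 * H * K)) + |t - s| ^ (2 * H * K) := by
    rcases le_total s t with h | h
    · exact two_mul_rpow_add_rpow_le hH0 hH1.le hK0 hK1 hs h
    · have := two_mul_rpow_add_rpow_le hH0 hH1.le hK0 hK1 ht h
      rwa [abs_sub_comm, add_comm (s ^ (2 * H)), add_comm (s ^ (2 * H * K))] at this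
  have hup := rpow_add_rpow_le_two_rpow_mul hK0 hK1
    (Real.rpow_nonneg ht (2 * H)) (Real.rpow_nonneg hs (2 * H))
  rw [← Real.rpow_mul ht, ← Real.rpow_mul hs] at hup
  have h2 : (2:ℝ) ^ (1 - K) = 2 * 2 ^ (-K) := by
    rw [sub_eq_add_neg, Real.rpow_add (by norm_num), Real.rpow_one]
  have hc : (2:ℝ) ^ (-K) * 2 ^ K = 1 := by
    rw [← Real.rpow_add (by norm_num)]; simp
  have hlow' := mul_le_mul_of_nonneg_left hlow (Real.rpow_nonneg (zero_le_two (α := ℝ)) (-K))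
  rw [mul_add, ← mul_assoc _ ((2:ℝ) ^ K), hc] at hlow'
  rw [hR s t hs ht, abs_sub_comm s t, h2]
  rw [h2] at hup
  constructor <;> linarith
end
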